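/- arXiv:1901.06300 — 8 statements merged into one kernel-verified Lean document; each statement's English description precedes it below -/
import Mathlib

section
/- (Moment matching of the nonlinear ensemble transform smoother.) Let M ≥ 1, let w ∈ ℝ^M be a probability vector, W = diag(w), let Δ = √M · (W − wwᵀ)^{1/2} (the unique symmetric positive semidefinite square root, scaled by √M), and let Ω ∈ ℝ^{M×M} be any orthogonal matrix with Ω𝟙 = 𝟙. Define the NETS transformation D = w𝟙ᵀ + ΔΩ. Then: (i) Dᵀ𝟙 = 𝟙 and D𝟙 = M·w; (ii) (D − w𝟙ᵀ)(D − w𝟙ᵀ)ᵀ = M(W − wwᵀ); and consequently (iii) for every n ≥ 1 and every ensemble X ∈ ℝ^{n×M}, the transformed ensemble XD has empirical mean Xw and empirical covariance (1/M)∑_{i}(\hat{x}^{(i)} − Xw)(\hat{x}^{(i)} − Xw)ᵀ equal to the importance-sampling covariance ∑_i w_i (x^{(i)} − Xw)(x^{(i)} − Xw)ᵀ, where \hat{x}^{(i)} are the columns of XD. -/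
open Matrix BigOperators

theorem sum_vecMulVec_col_self {m n R : Type*} [Fintype n] [CommSemiring R] (A : Matrix m n R) :
    ∑ i, vecMulVec (fun r => A r i) (fun r => A r i) = A * Aᵀ := by
  ext r s
  simp [Matrix.sum_apply, vecMulVec_apply, mul_apply]

/-- The covariance of the columns of `X` under weights `w` summing to one. -/
theorem sum_smul_vecMulVec_sub_mulVec {m n R : Type*} [Fintype n] [DecidableEq n] [CommRing R]
    (X : Matrix m n R) (w : n → R) (hw : ∑ i, w i = 1) :
    ∑ i, w i • vecMulVec (fun r => X r i - (X *ᵥ w) r) (fun r => X r i - (X *ᵥ w) r)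
      = X * (diagonal w - vecMulVec w w) * Xᵀ := by
  have hR : X * (diagonal w - vecMulVec w w) * Xᵀ
      = X * diagonal w * Xᵀ - vecMulVec (X *ᵥ w) (X *ᵥ w) := by
    rw [Matrix.mul_sub, Matrix.sub_mul, mul_vecMulVec, vecMulVec_mul, vecMul_transpose]
  rw [hR]
  ext r s
  have h (r : m) : ∑ i, w i * X r i = (X *ᵥ w) r := by
    simp only [mulVec, dotProduct, mul_comm]
  simp only [Matrix.sum_apply, Matrix.smul_apply, vecMulVec_apply, smul_eq_mul,
    Matrix.sub_apply]
  rw [mul_apply]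
  simp only [mul_diagonal, transpose_apply]
  calc ∑ i, w i * ((X r i - (X *ᵥ w) r) * (X s i - (X *ᵥ w) s))
      = ∑ i, (X r i * w i * X s i - w i * X r i * (X *ᵥ w) s
          - w i * X s i * (X *ᵥ w) r + w i * ((X *ᵥ w) r * (X *ᵥ w) s)) :=
        Finset.sum_congr rfl fun i _ => by ring
    _ = _ := by
        rw [Finset.sum_add_distrib, Finset.sum_sub_distrib, Finset.sum_sub_distrib,
          ← Finset.sum_mul, ← Finset.sum_mul, ← Finset.sum_mul, h, h, hw]
        ring

/-- Moment matching of the nonlinear ensemble transform smoother (NETS):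
with `Δ = √M (W - wwᵀ)^{1/2}` and any orthogonal `Ω` with `Ω𝟙 = 𝟙`, the
transformation `D = w𝟙ᵀ + ΔΩ` satisfies `Dᵀ𝟙 = 𝟙`, `D𝟙 = M w`, matches the
second-moment equation, and hence reproduces the importance-sampling mean and
covariance for every ensemble. -/
theorem nets_moment_matching
    (M : ℕ) (hM : 1 ≤ M) (w : Fin M → ℝ)
    (hw_nonneg : ∀ i, 0 ≤ w i) (hw_sum : ∑ i, w i = 1)
    (S : Matrix (Fin M) (Fin M) ℝ) (hS : S.PosSemidef)
    (hSsq : S * S = diagonal w - vecMulVec w w)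
    (Δ : Matrix (Fin M) (Fin M) ℝ) (hΔ : Δ = Real.sqrt M • S)
    (Ω : Matrix (Fin M) (Fin M) ℝ) (hΩ : Ωᵀ * Ω = 1)
    (hΩ1 : Ω *ᵥ (fun _ => (1 : ℝ)) = fun _ => 1)
    (D : Matrix (Fin M) (Fin M) ℝ)
    (hD : D = vecMulVec w (fun _ => 1) + Δ * Ω) :
    ((fun _ => (1 : ℝ)) ᵥ* D = fun _ => 1) ∧
    (D *ᵥ (fun _ => (1 : ℝ)) = (M : ℝ) • w) ∧
    ((D - vecMulVec w (fun _ => 1)) * (D - vecMulVec w (fun _ => 1))ᵀ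
      = (M : ℝ) • (diagonal w - vecMulVec w w)) ∧
    (∀ (n : ℕ), 1 ≤ n → ∀ X : Matrix (Fin n) (Fin M) ℝ,
      (M : ℝ)⁻¹ • ((X * D) *ᵥ (fun _ => (1 : ℝ))) = X *ᵥ w ∧
      (M : ℝ)⁻¹ • ∑ i, vecMulVec (fun r => (X * D) r i - (X *ᵥ w) r)
          (fun r => (X * D) r i - (X *ᵥ w) r)
        = ∑ i, w i • vecMulVec (fun r => X r i - (X *ᵥ w) r)
            (fun r => X r i - (X *ᵥ w) r)) := by
  have hST : Sᵀ = S := by simpa using hS.isHermitian.eq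
  have hw1 : w ⬝ᵥ (fun _ => (1 : ℝ)) = 1 := by simpa [dotProduct] using hw_sum
  have hS1 : S *ᵥ (fun _ => (1 : ℝ)) = 0 := by
    rw [← conjTranspose_mul_self_mulVec_eq_zero, hS.isHermitian.eq, hSsq, sub_mulVec,
      vecMulVec_mulVec, hw1]
    ext i
    simp [mulVec_diagonal]
  have h1S : (fun _ => (1 : ℝ)) ᵥ* S = 0 := by rw [← mulVec_transpose, hST, hS1]
  have hD1 : D *ᵥ (fun _ => (1 : ℝ)) = (M : ℝ) • w := by
    rw [hD, hΔ, add_mulVec, vecMulVec_mulVec, ← mulVec_mulVec, hΩ1, smul_mulVec, hS1]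
    ext i
    simp [dotProduct, mul_comm]
  have hcov : (D - vecMulVec w (fun _ => 1)) * (D - vecMulVec w (fun _ => 1))ᵀ
      = (M : ℝ) • (diagonal w - vecMulVec w w) := by
    have hΩ' : Ω * Ωᵀ = 1 := mul_eq_one_comm.mp hΩ
    rw [hD, add_sub_cancel_left, transpose_mul, Matrix.mul_assoc, ← Matrix.mul_assoc Ω, hΩ',
      Matrix.one_mul, hΔ, transpose_smul, hST, Matrix.smul_mul, Matrix.mul_smul, smul_smul,
      Real.mul_self_sqrt M.cast_nonneg, hSsq]
  have hM0 : (M : ℝ) ≠ 0 := by positivity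
  refine ⟨?_, hD1, hcov, fun n _ X => ⟨?_, ?_⟩⟩
  · rw [hD, hΔ, vecMul_add, vecMul_vecMulVec, ← vecMul_vecMul, vecMul_smul, h1S,
      dotProduct_comm, hw1]
    simp
  · rw [← mulVec_mulVec, hD1, mulVec_smul, inv_smul_smul₀ hM0]
  · have hA : ∀ r i, (X * D) r i - (X *ᵥ w) r
        = (X * (D - vecMulVec w (fun _ => 1)) : Matrix (Fin n) (Fin M) ℝ) r i := fun r i => by
      rw [Matrix.mul_sub, mul_vecMulVec, Matrix.sub_apply, vecMulVec_apply, mul_one]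
    simp only [hA]
    rw [sum_vecMulVec_col_self, sum_smul_vecMulVec_sub_mulVec X w hw_sum, transpose_mul,
      Matrix.mul_assoc, ← Matrix.mul_assoc (D - _), hcov, Matrix.smul_mul, Matrix.mul_smul,
      inv_smul_smul₀ hM0, Matrix.mul_assoc]
end

section
/- (Second-order correction via the algebraic Riccati equation.) Let M ≥ 1, let w ∈ ℝ^M be a probability vector, W = diag(w), and let D ∈ ℝ^{M×M} satisfy Dᵀ𝟙 = 𝟙 and D𝟙 = M·w. Suppose Δ ∈ ℝ^{M×M} satisfies Δᵀ𝟙 = 0, Δ𝟙 = 0 and the algebraic Riccati equation M(W − wwᵀ) − (D − w𝟙ᵀ)(D − w𝟙ᵀ)ᵀ = (D − w𝟙ᵀ)Δᵀ + Δ(D − w𝟙ᵀ)ᵀ + ΔΔᵀ. Then the corrected transformation D̂ = D + Δ satisfies D̂ᵀ𝟙 = 𝟙, D̂𝟙 = M·w, and (D̂ − w𝟙ᵀ)(D̂ − w𝟙ᵀ)ᵀ = M(W − wwᵀ); consequently, for every n ≥ 1 and every ensemble X ∈ ℝ^{n×M}, the transformed ensemble XD̂ has empirical mean Xw and empirical covariance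 equal to the importance-sampling covariance ∑_i w_i (x^{(i)} − Xw)(x^{(i)} − Xw)ᵀ. -/
open Matrix BigOperators

/-- The scatter matrix of the columns of an ensemble `Y` about a point `m`. -/
theorem Matrix.sum_vecMulVec_col_sub {ι κ : Type*} [Fintype κ]
    (Y : Matrix ι κ ℝ) (m : ι → ℝ) :
    ∑ i, vecMulVec (fun r => Y r i - m r) (fun r => Y r i - m r)
      = (Y - vecMulVec m (fun _ => 1)) * (Y - vecMulVec m (fun _ => 1))ᵀ := by
  ext a b
  simp [Matrix.sum_apply, Matrix.mul_apply, vecMulVec_apply]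

/-- The importance-sampling covariance of an ensemble `X` with weights `w` of total mass one. -/
theorem Matrix.sum_smul_vecMulVec_col_sub_mulVec {ι κ : Type*} [Fintype κ] [DecidableEq κ]
    (X : Matrix ι κ ℝ) (w : κ → ℝ) (hw : ∑ i, w i = 1) :
    ∑ i, w i • vecMulVec (fun r => X r i - (X *ᵥ w) r) (fun r => X r i - (X *ᵥ w) r)
      = X * (diagonal w - vecMulVec w w) * Xᵀ := by
  rw [Matrix.mul_sub, Matrix.sub_mul, mul_vecMulVec, vecMulVec_mul, vecMul_transpose]
  ext a b
  have ha : ∑ i, w i * X a i = (X *ᵥ w) a := by simp [mulVec, dotProduct, mul_comm]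
  have hb : ∑ i, w i * X b i = (X *ᵥ w) b := by simp [mulVec, dotProduct, mul_comm]
  simp only [Matrix.sum_apply, Matrix.smul_apply, Matrix.sub_apply, vecMulVec_apply, smul_eq_mul,
    Matrix.mul_apply (M := X * diagonal w), Matrix.mul_diagonal, transpose_apply]
  calc ∑ i, w i * ((X a i - (X *ᵥ w) a) * (X b i - (X *ᵥ w) b))
      = ∑ i, (X a i * w i * X b i - w i * X a i * (X *ᵥ w) b
          - w i * X b i * (X *ᵥ w) a + w i * ((X *ᵥ w) a * (X *ᵥ w) b)) :=
        Finset.sum_congr rfl fun i _ => by ring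
    _ = _ := by
        rw [Finset.sum_add_distrib, Finset.sum_sub_distrib, Finset.sum_sub_distrib,
          ← Finset.sum_mul, ← Finset.sum_mul, ← Finset.sum_mul, ha, hb, hw]
        ring

/-- Second-order correction via the algebraic Riccati equation: if `Δ` with
`Δᵀ𝟙 = 0`, `Δ𝟙 = 0` solves the Riccati equation associated with a transformation
`D` (with `Dᵀ𝟙 = 𝟙`, `D𝟙 = M w`), then the corrected transformation `D + Δ` is
second-order accurate: it preserves `Dᵀ𝟙 = 𝟙`, `D𝟙 = M w`, satisfies the
second-moment equation, and hence reproduces the importance-sampling mean and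
covariance for every ensemble. -/
theorem riccati_second_order_correction
    (M : ℕ) (hM : 1 ≤ M) (w : Fin M → ℝ)
    (hw_nonneg : ∀ i, 0 ≤ w i) (hw_sum : ∑ i, w i = 1)
    (D Δ : Matrix (Fin M) (Fin M) ℝ)
    (hD1 : (fun _ => (1 : ℝ)) ᵥ* D = fun _ => 1)
    (hD2 : D *ᵥ (fun _ => (1 : ℝ)) = (M : ℝ) • w)
    (hΔ1 : (fun _ => (1 : ℝ)) ᵥ* Δ = 0)
    (hΔ2 : Δ *ᵥ (fun _ => (1 : ℝ)) = 0)
    (hRiccati :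
      (M : ℝ) • (diagonal w - vecMulVec w w)
          - (D - vecMulVec w (fun _ => 1)) * (D - vecMulVec w (fun _ => 1))ᵀ
        = (D - vecMulVec w (fun _ => 1)) * Δᵀ
          + Δ * (D - vecMulVec w (fun _ => 1))ᵀ + Δ * Δᵀ) :
    ((fun _ => (1 : ℝ)) ᵥ* (D + Δ) = fun _ => 1) ∧
    ((D + Δ) *ᵥ (fun _ => (1 : ℝ)) = (M : ℝ) • w) ∧
    ((D + Δ - vecMulVec w (fun _ => 1)) * (D + Δ - vecMulVec w (fun _ => 1))ᵀ
      = (M : ℝ) • (diagonal w - vecMulVec w w)) ∧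
    (∀ (n : ℕ), 1 ≤ n → ∀ X : Matrix (Fin n) (Fin M) ℝ,
      (M : ℝ)⁻¹ • ((X * (D + Δ)) *ᵥ (fun _ => (1 : ℝ))) = X *ᵥ w ∧
      (M : ℝ)⁻¹ • ∑ i, vecMulVec (fun r => (X * (D + Δ)) r i - (X *ᵥ w) r)
          (fun r => (X * (D + Δ)) r i - (X *ᵥ w) r)
        = ∑ i, w i • vecMulVec (fun r => X r i - (X *ᵥ w) r)
            (fun r => X r i - (X *ᵥ w) r)) := by
  have hmean : (D + Δ) *ᵥ (fun _ => (1 : ℝ)) = (M : ℝ) • w := by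
    rw [add_mulVec, hD2, hΔ2, add_zero]
  have hcov : (D + Δ - vecMulVec w (fun _ => 1)) * (D + Δ - vecMulVec w (fun _ => 1))ᵀ
      = (M : ℝ) • (diagonal w - vecMulVec w w) := by
    rw [sub_eq_iff_eq_add] at hRiccati
    rw [hRiccati, add_sub_right_comm, transpose_add, Matrix.add_mul, Matrix.mul_add,
      Matrix.mul_add]
    abel
  have hM0 : (M : ℝ) ≠ 0 := Nat.cast_ne_zero.mpr (Nat.one_le_iff_ne_zero.mp hM)
  refine ⟨by rw [vecMul_add, hD1, hΔ1, add_zero], hmean, hcov, fun n _ X => ⟨?_, ?_⟩⟩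
  · rw [← mulVec_mulVec, hmean, mulVec_smul, inv_smul_smul₀ hM0]
  · rw [sum_vecMulVec_col_sub, sum_smul_vecMulVec_col_sub_mulVec X w hw_sum, ← mul_vecMulVec,
      ← Matrix.mul_sub, transpose_mul, Matrix.mul_assoc, ← Matrix.mul_assoc _ _ Xᵀ, hcov,
      Matrix.smul_mul, Matrix.mul_smul, inv_smul_smul₀ hM0, Matrix.mul_assoc]
end

section
/- Let B ∈ ℝ^{M×M} be symmetric positive semidefinite with B𝟙 = 0, where 𝟙 ∈ ℝ^M is the all-ones vector. Then: (i) I + B is symmetric positive definite, hence invertible; (ii) (I + B)^{-1}𝟙 = 𝟙; and (iii) the unique symmetric positive semidefinite square root S of (I + B)^{-1} satisfies S𝟙 = 𝟙 (equivalently 𝟙ᵀS = 𝟙ᵀ). -/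
open Matrix BigOperators

namespace Matrix

variable {n : Type*} [Fintype n] [DecidableEq n]

/-- A positive semidefinite square root of a matrix fixes every vector fixed by that matrix. -/
theorem PosSemidef.mulVec_eq_self_of_mul_self_mulVec_eq_self {S : Matrix n n ℝ}
    (hS : S.PosSemidef) {v : n → ℝ} (hv : (S * S) *ᵥ v = v) : S *ᵥ v = v := by
  have hunit : IsUnit (1 + S) := (PosDef.one.add_posSemidef hS).isUnit
  refine mulVec_injective_of_isUnit hunit ?_
  rw [add_mulVec, add_mulVec, one_mulVec, one_mulVec, mulVec_mulVec, hv, add_comm]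

end Matrix

/-- If `B` is symmetric positive semidefinite with `B𝟙 = 0`, then `I + B` is
positive definite (hence invertible), its inverse fixes `𝟙`, and the (unique
symmetric positive semidefinite) square root of `(I + B)⁻¹` also fixes `𝟙`. -/
theorem esrf_transform_fixes_ones
    (M : ℕ) (B : Matrix (Fin M) (Fin M) ℝ) (hB : B.PosSemidef)
    (hB1 : B *ᵥ (fun _ => (1 : ℝ)) = 0) :
    (1 + B).PosDef ∧ IsUnit (1 + B).det ∧
    ((1 + B)⁻¹ *ᵥ (fun _ => (1 : ℝ)) = fun _ => 1) ∧
    (∀ S : Matrix (Fin M) (Fin M) ℝ, S.PosSemidef → S * S = (1 + B)⁻¹ →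
      (S *ᵥ (fun _ => (1 : ℝ)) = fun _ => 1) ∧
      ((fun _ => (1 : ℝ)) ᵥ* S = fun _ => 1)) := by
  have hpos : (1 + B).PosDef := PosDef.one.add_posSemidef hB
  have hdet : IsUnit (1 + B).det := (isUnit_iff_isUnit_det _).mp hpos.isUnit
  have hinv : (1 + B)⁻¹ *ᵥ (fun _ => (1 : ℝ)) = fun _ => 1 := by
    refine mulVec_injective_of_isUnit hpos.isUnit ?_
    simp only [mulVec_mulVec, mul_nonsing_inv _ hdet, add_mulVec, one_mulVec, hB1, add_zero]
  refine ⟨hpos, hdet, hinv, fun S hS hSS => ?_⟩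
  have hfix : S *ᵥ (fun _ => (1 : ℝ)) = fun _ => 1 :=
    hS.mulVec_eq_self_of_mul_self_mulVec_eq_self (hSS ▸ hinv)
  refine ⟨hfix, ?_⟩
  have hsymm : Sᵀ = S := by simpa using hS.isHermitian.eq
  rw [← mulVec_transpose, hsymm, hfix]
end

section
/- (Mean update of the ensemble square root smoother.) Let M ≥ 2, let X ∈ ℝ^{n×M} be an ensemble with empirical mean m = (1/M)X𝟙 and deviation matrix A = X − m𝟙ᵀ (so A𝟙 = 0). Let H ∈ ℝ^{p×n}, let R ∈ ℝ^{p×p} be symmetric positive definite, and let y ∈ ℝ^p. Set B = (1/(M−1))(HA)ᵀR^{-1}(HA), let S be the unique symmetric positive semidefinite square root of (I + B)^{-1}, let ŵ = (1/(M−1))S²(HA)ᵀR^{-1}(y − Hm), and let D = ŵ𝟙ᵀ + S be the ESRS transformation. Then 𝟙ᵀŵ = 0 and the empirical mean of the transformed ensemble is (1/M)(XD)𝟙 = m + Aŵ = m + (1/(M−1))A S²(HA)ᵀR^{-1}(y − Hm). -/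
open Matrix BigOperators

namespace Matrix

/-- A fixed vector of the square of a positive semidefinite matrix is already fixed by the
matrix itself. -/
theorem PosSemidef.mulVec_eq_self_of_mul_self {ι : Type*} [Fintype ι] [DecidableEq ι]
    {S : Matrix ι ι ℝ} (hS : S.PosSemidef) {v : ι → ℝ} (hv : (S * S) *ᵥ v = v) :
    S *ᵥ v = v := by
  have hunit : IsUnit (1 + S) := (PosDef.one.add_posSemidef hS).isUnit
  have heq : (1 + S) *ᵥ (S *ᵥ v) = (1 + S) *ᵥ v := by
    rw [add_mulVec, add_mulVec, one_mulVec, one_mulVec, mulVec_mulVec, hv, add_comm]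
  exact mulVec_injective_of_isUnit hunit heq

/-- The inverse of an invertible matrix `1 + B` fixes every vector in the kernel of `B`. -/
theorem inv_one_add_mulVec_of_mulVec_eq_zero {ι : Type*} [Fintype ι] [DecidableEq ι]
    {B : Matrix ι ι ℝ} (hB : IsUnit (1 + B)) {v : ι → ℝ} (hv : B *ᵥ v = 0) :
    (1 + B)⁻¹ *ᵥ v = v := by
  have hfix : (1 + B) *ᵥ v = v := by rw [add_mulVec, one_mulVec, hv, add_zero]
  calc (1 + B)⁻¹ *ᵥ v = (1 + B)⁻¹ *ᵥ ((1 + B) *ᵥ v) := by rw [hfix]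
    _ = v := by
      rw [mulVec_mulVec, nonsing_inv_mul _ ((isUnit_iff_isUnit_det _).mp hB), one_mulVec]

end Matrix

/-- Mean update of the ensemble square root smoother: with the ESRS transformation
`D = wHat𝟙ᵀ + S`, one has `𝟙ᵀwHat = 0` and the empirical mean of the transformed ensemble
is `m + AwHat = m + (1/(M-1)) A S² (HA)ᵀ R⁻¹ (y - Hm)`. -/
theorem esrs_mean_update
    (M n p : ℕ) (hM : 2 ≤ M)
    (X : Matrix (Fin n) (Fin M) ℝ)
    (m : Fin n → ℝ) (hm : m = (M : ℝ)⁻¹ • (X *ᵥ (fun _ => (1 : ℝ))))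
    (A : Matrix (Fin n) (Fin M) ℝ) (hA : A = X - vecMulVec m (fun _ => 1))
    (H : Matrix (Fin p) (Fin n) ℝ)
    (R : Matrix (Fin p) (Fin p) ℝ) (hR : R.PosDef)
    (y : Fin p → ℝ)
    (B : Matrix (Fin M) (Fin M) ℝ)
    (hB : B = ((M : ℝ) - 1)⁻¹ • ((H * A)ᵀ * R⁻¹ * (H * A)))
    (S : Matrix (Fin M) (Fin M) ℝ) (hS : S.PosSemidef) (hSsq : S * S = (1 + B)⁻¹)
    (wHat : Fin M → ℝ)
    (hwHat : wHat = ((M : ℝ) - 1)⁻¹ •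
      ((S * S) *ᵥ ((H * A)ᵀ *ᵥ (R⁻¹ *ᵥ (y - H *ᵥ m)))))
    (D : Matrix (Fin M) (Fin M) ℝ)
    (hD : D = vecMulVec wHat (fun _ => 1) + S) :
    ((fun _ => (1 : ℝ)) ⬝ᵥ wHat = 0) ∧
    ((M : ℝ)⁻¹ • ((X * D) *ᵥ (fun _ => (1 : ℝ))) = m + A *ᵥ wHat) ∧
    (m + A *ᵥ wHat
      = m + ((M : ℝ) - 1)⁻¹ •
          (A *ᵥ ((S * S) *ᵥ ((H * A)ᵀ *ᵥ (R⁻¹ *ᵥ (y - H *ᵥ m)))))) := by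
  have hM0 : (M : ℝ) ≠ 0 := by positivity
  have hM1 : (0 : ℝ) ≤ ((M : ℝ) - 1)⁻¹ := by
    have : (2 : ℝ) ≤ M := by exact_mod_cast hM
    exact inv_nonneg.mpr (by linarith)
  set e : Fin M → ℝ := fun _ => 1 with he
  have hee : e ⬝ᵥ e = M := by simp [he, dotProduct]
  have hXe : X *ᵥ e = (M : ℝ) • m := by rw [hm, smul_inv_smul₀ hM0]
  have hAe : A *ᵥ e = 0 := by
    rw [hA, sub_mulVec, vecMulVec_mulVec, hee, hXe, op_smul_eq_smul, sub_self]
  have hHAe : (H * A) *ᵥ e = 0 := by rw [← mulVec_mulVec, hAe, mulVec_zero]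
  have hBe : B *ᵥ e = 0 := by
    rw [hB, smul_mulVec, ← mulVec_mulVec, hHAe, mulVec_zero, smul_zero]
  have hBpsd : B.PosSemidef := by
    rw [hB, ← conjTranspose_eq_transpose_of_trivial]
    exact (hR.inv.posSemidef.conjTranspose_mul_mul_same (H * A)).smul hM1
  have hSSe : (S * S) *ᵥ e = e := by
    rw [hSsq]
    exact inv_one_add_mulVec_of_mulVec_eq_zero (PosDef.one.add_posSemidef hBpsd).isUnit hBe
  have hSe : S *ᵥ e = e := hS.mulVec_eq_self_of_mul_self hSSe
  have hSt : Sᵀ = S := by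
    rw [← conjTranspose_eq_transpose_of_trivial]
    exact hS.isHermitian
  have hew : e ⬝ᵥ wHat = 0 := by
    rw [hwHat, dotProduct_smul, dotProduct_mulVec, ← mulVec_transpose, transpose_mul, hSt, hSSe,
      dotProduct_mulVec, vecMul_transpose, hHAe, zero_dotProduct, smul_zero]
  have hXw : X *ᵥ wHat = A *ᵥ wHat := by
    rw [hA, sub_mulVec, vecMulVec_mulVec, hew]
    simp
  refine ⟨hew, ?_, ?_⟩
  · have hDe : D *ᵥ e = (M : ℝ) • wHat + e := by
      rw [hD, add_mulVec, vecMulVec_mulVec, hee, hSe, op_smul_eq_smul]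
    rw [← mulVec_mulVec, hDe, mulVec_add, mulVec_smul, hXw, hXe, ← smul_add, inv_smul_smul₀ hM0,
      add_comm]
  · rw [hwHat, mulVec_smul]
end

section
/- (Covariance update of the ensemble square root smoother.) Let M ≥ 2, let X ∈ ℝ^{n×M} be an ensemble with empirical mean m = (1/M)X𝟙 and deviation matrix A = X − m𝟙ᵀ. Let H ∈ ℝ^{p×n}, R ∈ ℝ^{p×p} symmetric positive definite, y ∈ ℝ^p, B = (1/(M−1))(HA)ᵀR^{-1}(HA), S the unique symmetric positive semidefinite square root of (I + B)^{-1}, ŵ = (1/(M−1))S²(HA)ᵀR^{-1}(y − Hm), and D = ŵ𝟙ᵀ + S. Then the deviation matrix of the transformed ensemble XD equals AS, i.e. XD − ((1/M)(XD)𝟙)𝟙ᵀ = AS, and hence the empirical analysis covariance is (1/(M−1))(AS)(AS)ᵀ = (1/(M−1))A(I + B)^{-1}Aᵀ. -/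
open Matrix BigOperators

namespace Matrix

/-- A fixed vector of an invertible matrix is fixed by its inverse. -/
theorem inv_mulVec_eq_self {ι K : Type*} [Fintype ι] [DecidableEq ι] [CommRing K]
    {C : Matrix ι ι K} (hC : IsUnit C) {v : ι → K} (hv : C *ᵥ v = v) : C⁻¹ *ᵥ v = v := by
  have hdet : IsUnit C.det := (isUnit_iff_isUnit_det C).mp hC
  calc C⁻¹ *ᵥ v = C⁻¹ *ᵥ (C *ᵥ v) := by rw [hv]
    _ = v := by rw [mulVec_mulVec, nonsing_inv_mul C hdet, one_mulVec]

theorem vecMulVec_one_mulVec_one {ι R : Type*} [CommSemiring R] (M : ℕ) (u : ι → R) :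
    vecMulVec u (fun _ : Fin M => (1 : R)) *ᵥ (fun _ => 1) = (M : R) • u := by
  ext i
  simp [mulVec, vecMulVec_apply, dotProduct]

/-- The columns of a deviation matrix sum to zero. -/
theorem sub_vecMulVec_mean_mulVec_one {ι : Type*} {M : ℕ} (hM : M ≠ 0)
    (X : Matrix ι (Fin M) ℝ) :
    (X - vecMulVec ((M : ℝ)⁻¹ • (X *ᵥ fun _ => (1 : ℝ))) fun _ => 1) *ᵥ (fun _ => (1 : ℝ)) = 0 := by
  have hM' : (M : ℝ) ≠ 0 := Nat.cast_ne_zero.mpr hM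
  rw [sub_mulVec, vecMulVec_one_mulVec_one, smul_inv_smul₀ hM', sub_self]

/-- If `S` is symmetric and fixes the all-ones vector, then the deviation matrix of
`X (w𝟙ᵀ + S)` is the deviation matrix of `X` times `S`. -/
theorem deviation_mul_vecMulVec_add {ι : Type*} {M : ℕ} (hM : M ≠ 0)
    (X : Matrix ι (Fin M) ℝ) (w : Fin M → ℝ) {S : Matrix (Fin M) (Fin M) ℝ}
    (hSt : Sᵀ = S) (hS : S *ᵥ (fun _ => (1 : ℝ)) = fun _ => 1) :
    X * (vecMulVec w (fun _ => 1) + S) - vecMulVec ((M : ℝ)⁻¹ •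
        ((X * (vecMulVec w (fun _ => 1) + S)) *ᵥ (fun _ => (1 : ℝ)))) (fun _ => 1)
      = (X - vecMulVec ((M : ℝ)⁻¹ • (X *ᵥ fun _ => (1 : ℝ))) fun _ => 1) * S := by
  have hM' : (M : ℝ) ≠ 0 := Nat.cast_ne_zero.mpr hM
  have hSl : (fun _ => (1 : ℝ)) ᵥ* S = fun _ => 1 := by
    rw [← mulVec_transpose, hSt, hS]
  have hmean : (M : ℝ)⁻¹ • ((X * (vecMulVec w (fun _ => 1) + S)) *ᵥ (fun _ => (1 : ℝ)))
      = X *ᵥ w + (M : ℝ)⁻¹ • (X *ᵥ fun _ => (1 : ℝ)) := by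
    rw [← mulVec_mulVec, add_mulVec, hS, mulVec_add, smul_add,
      vecMulVec_one_mulVec_one, mulVec_smul, inv_smul_smul₀ hM']
  rw [hmean, Matrix.mul_add, Matrix.sub_mul, mul_vecMulVec, vecMulVec_mul, hSl, add_vecMulVec]
  abel

end Matrix

/-- Covariance update of the ensemble square root smoother: with the ESRS
transformation `D = ŵ𝟙ᵀ + S`, the deviation matrix of the transformed ensemble
`X * D` equals `A * S`, and the empirical analysis covariance is
`(1/(M-1)) (AS)(AS)ᵀ = (1/(M-1)) A (I + B)⁻¹ Aᵀ`. -/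
theorem esrs_covariance_update
    (M n p : ℕ) (hM : 2 ≤ M)
    (X : Matrix (Fin n) (Fin M) ℝ)
    (m : Fin n → ℝ) (hm : m = (M : ℝ)⁻¹ • (X *ᵥ (fun _ => (1 : ℝ))))
    (A : Matrix (Fin n) (Fin M) ℝ) (hA : A = X - vecMulVec m (fun _ => 1))
    (H : Matrix (Fin p) (Fin n) ℝ)
    (R : Matrix (Fin p) (Fin p) ℝ) (hR : R.PosDef)
    (y : Fin p → ℝ)
    (B : Matrix (Fin M) (Fin M) ℝ)
    (hB : B = ((M : ℝ) - 1)⁻¹ • ((H * A)ᵀ * R⁻¹ * (H * A)))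
    (S : Matrix (Fin M) (Fin M) ℝ) (hS : S.PosSemidef) (hSsq : S * S = (1 + B)⁻¹)
    (wHat : Fin M → ℝ)
    (hwHat : wHat = ((M : ℝ) - 1)⁻¹ •
      ((S * S) *ᵥ ((H * A)ᵀ *ᵥ (R⁻¹ *ᵥ (y - H *ᵥ m)))))
    (D : Matrix (Fin M) (Fin M) ℝ)
    (hD : D = vecMulVec wHat (fun _ => 1) + S) :
    (X * D - vecMulVec ((M : ℝ)⁻¹ • ((X * D) *ᵥ (fun _ => (1 : ℝ)))) (fun _ => 1)
      = A * S) ∧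
    (((M : ℝ) - 1)⁻¹ • ((A * S) * (A * S)ᵀ)
      = ((M : ℝ) - 1)⁻¹ • (A * (1 + B)⁻¹ * Aᵀ)) := by
  have hM0 : M ≠ 0 := by omega
  have hM1 : (0 : ℝ) ≤ ((M : ℝ) - 1)⁻¹ := by
    have : (2 : ℝ) ≤ M := by exact_mod_cast hM
    exact inv_nonneg.mpr (by linarith)
  have hSt : Sᵀ = S := by simpa using hS.isHermitian.eq
  have hA1 : A *ᵥ (fun _ => (1 : ℝ)) = 0 := by
    rw [hA, hm]
    exact sub_vecMulVec_mean_mulVec_one hM0 X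
  have hB1 : (1 + B) *ᵥ (fun _ => (1 : ℝ)) = fun _ => 1 := by
    rw [add_mulVec, one_mulVec, hB, smul_mulVec, ← mulVec_mulVec, ← mulVec_mulVec,
      ← mulVec_mulVec, hA1]
    simp
  have hBpsd : B.PosSemidef := by
    rw [hB]
    have h := hR.inv.posSemidef.conjTranspose_mul_mul_same (H * A)
    rw [conjTranspose_eq_transpose_of_trivial] at h
    exact h.smul hM1
  have hS1 : S *ᵥ (fun _ => (1 : ℝ)) = fun _ => 1 := by
    apply hS.mulVec_eq_self_of_mul_self
    rw [hSsq]
    exact inv_mulVec_eq_self (PosDef.one.add_posSemidef hBpsd).isUnit hB1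
  constructor
  · rw [hD, hA, hm]
    exact deviation_mul_vecMulVec_add hM0 X wHat hSt hS1
  · rw [transpose_mul, hSt, Matrix.mul_assoc, ← Matrix.mul_assoc S, hSsq, ← Matrix.mul_assoc]
end

section
/- (The ESRS analysis covariance equals the Kalman analysis covariance.) Let M ≥ 2, A ∈ ℝ^{n×M}, H ∈ ℝ^{p×n}, and let R ∈ ℝ^{p×p} be symmetric positive definite. Define the forecast covariance P^f = (1/(M−1))AAᵀ. Then HP^fHᵀ + R is positive definite (hence invertible), the matrix I + (1/(M−1))(HA)ᵀR^{-1}(HA) is positive definite (hence invertible), and the identity (1/(M−1))·A·(I + (1/(M−1))(HA)ᵀR^{-1}HA)^{-1}·Aᵀ = P^f − P^fHᵀ(HP^fHᵀ + R)^{-1}HP^f holds. -/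
open Matrix BigOperators

/-- The ESRS analysis covariance equals the Kalman analysis covariance:
`(1/(M-1)) A (I + (1/(M-1))(HA)ᵀR⁻¹HA)⁻¹ Aᵀ = P^f - P^f Hᵀ (H P^f Hᵀ + R)⁻¹ H P^f`,
where `P^f = (1/(M-1)) A Aᵀ`. -/
theorem esrs_covariance_equals_kalman
    (M n p : ℕ) (hM : 2 ≤ M)
    (A : Matrix (Fin n) (Fin M) ℝ) (H : Matrix (Fin p) (Fin n) ℝ)
    (R : Matrix (Fin p) (Fin p) ℝ) (hR : R.PosDef)
    (Pf : Matrix (Fin n) (Fin n) ℝ) (hPf : Pf = ((M : ℝ) - 1)⁻¹ • (A * Aᵀ)) :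
    (H * Pf * Hᵀ + R).PosDef ∧
    (1 + ((M : ℝ) - 1)⁻¹ • ((H * A)ᵀ * R⁻¹ * (H * A))).PosDef ∧
    ((M : ℝ) - 1)⁻¹ •
        (A * (1 + ((M : ℝ) - 1)⁻¹ • ((H * A)ᵀ * R⁻¹ * (H * A)))⁻¹ * Aᵀ)
      = Pf - Pf * Hᵀ * (H * Pf * Hᵀ + R)⁻¹ * H * Pf := by
  have hM' : (2 : ℝ) ≤ M := by exact_mod_cast hM
  have hc : (0 : ℝ) ≤ ((M : ℝ) - 1)⁻¹ := inv_nonneg.mpr (by linarith)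
  generalize ((M : ℝ) - 1)⁻¹ = c at *
  subst hPf
  have hS : H * (c • (A * Aᵀ)) * Hᵀ = c • (H * A * (H * A)ᵀ) := by
    simp only [Matrix.mul_smul, Matrix.smul_mul, Matrix.transpose_mul, Matrix.mul_assoc]
  have hPos : (H * (c • (A * Aᵀ)) * Hᵀ + R).PosDef := by
    rw [hS]
    have h := (Matrix.posSemidef_self_mul_conjTranspose (H * A)).smul hc
    rw [Matrix.conjTranspose_eq_transpose_of_trivial] at h
    exact Matrix.PosDef.posSemidef_add h hR
  refine ⟨hPos, ?_, ?_⟩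
  · have h := (hR.inv.posSemidef.conjTranspose_mul_mul_same (H * A)).smul hc
    rw [Matrix.conjTranspose_eq_transpose_of_trivial] at h
    exact Matrix.PosDef.one.add_posSemidef h
  · have hU : IsUnit R := hR.isUnit
    have hInner : R⁻¹⁻¹ + H * A * (1 : Matrix (Fin M) (Fin M) ℝ)⁻¹ * (c • (H * A)ᵀ)
        = H * (c • (A * Aᵀ)) * Hᵀ + R := by
      rw [hS, Matrix.nonsing_inv_nonsing_inv _ ((Matrix.isUnit_iff_isUnit_det R).mp hU),
        inv_one, Matrix.mul_one, Matrix.mul_smul, add_comm]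
    have h := Matrix.add_mul_mul_inv_eq_sub (1 : Matrix (Fin M) (Fin M) ℝ)
      (c • (H * A)ᵀ) R⁻¹ (H * A) isUnit_one hR.inv.isUnit (hInner ▸ hPos.isUnit)
    rw [hInner, inv_one, Matrix.one_mul, Matrix.mul_one, Matrix.smul_mul, Matrix.smul_mul] at h
    rw [h]
    simp only [Matrix.mul_sub, Matrix.sub_mul, Matrix.mul_one, smul_sub, Matrix.mul_smul,
      Matrix.smul_mul, Matrix.transpose_mul, Matrix.mul_assoc]
end

section
/- (The ESRS analysis mean increment equals the Kalman gain increment.) Let M ≥ 2, A ∈ ℝ^{n×M}, H ∈ ℝ^{p×n}, and let R ∈ ℝ^{p×p} be symmetric positive definite. Define P^f = (1/(M−1))AAᵀ. Then the identity (1/(M−1))·A·(I + (1/(M−1))(HA)ᵀR^{-1}HA)^{-1}·(HA)ᵀR^{-1} = P^fHᵀ(HP^fHᵀ + R)^{-1} holds; in particular, for every y ∈ ℝ^p and m ∈ ℝ^n, the ESRS mean update m + (1/(M−1))A S²(HA)ᵀR^{-1}(y − Hm), with S² = (I + (1/(M−1))(HA)ᵀR^{-1}HA)^{-1}, equals the Kalman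 mean update m + K(y − Hm) with Kalman gain K = P^fHᵀ(HP^fHᵀ + R)^{-1}. -/
open Matrix BigOperators

/-- Push-through identity relating the ensemble-space and observation-space forms of the gain. -/
theorem Matrix.PosDef.inv_one_add_smul_mul_transpose_mul_inv {m k : Type*} [Fintype m] [Fintype k]
    [DecidableEq m] [DecidableEq k] {R : Matrix m m ℝ} (hR : R.PosDef) (B : Matrix m k ℝ)
    {c : ℝ} (hc : 0 ≤ c) :
    (1 + c • (Bᵀ * R⁻¹ * B))⁻¹ * Bᵀ * R⁻¹ = Bᵀ * (c • (B * Bᵀ) + R)⁻¹ := by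
  have hS : (1 + c • (Bᵀ * R⁻¹ * B)).PosDef := by
    have h := hR.inv.posSemidef.conjTranspose_mul_mul_same B
    rw [conjTranspose_eq_transpose_of_trivial] at h
    exact PosDef.one.add_posSemidef (h.smul hc)
  have hT : (c • (B * Bᵀ) + R).PosDef := by
    have h := posSemidef_self_mul_conjTranspose B
    rw [conjTranspose_eq_transpose_of_trivial] at h
    exact PosDef.posSemidef_add (h.smul hc) hR
  have hRu := (isUnit_iff_isUnit_det _).mp hR.isUnit
  have hSu := (isUnit_iff_isUnit_det _).mp hS.isUnit
  have hTu := (isUnit_iff_isUnit_det _).mp hT.isUnit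
  have key : (1 + c • (Bᵀ * R⁻¹ * B)) * Bᵀ = Bᵀ * R⁻¹ * (c • (B * Bᵀ) + R) := by
    rw [Matrix.add_mul, Matrix.mul_add, nonsing_inv_mul_cancel_right _ _ hRu, Matrix.one_mul,
      Matrix.smul_mul, Matrix.mul_smul, add_comm, Matrix.mul_assoc _ B]
  calc (1 + c • (Bᵀ * R⁻¹ * B))⁻¹ * Bᵀ * R⁻¹
      = (1 + c • (Bᵀ * R⁻¹ * B))⁻¹ *
          (Bᵀ * R⁻¹ * (c • (B * Bᵀ) + R) * (c • (B * Bᵀ) + R)⁻¹) := by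
        rw [mul_nonsing_inv_cancel_right _ _ hTu, Matrix.mul_assoc]
    _ = Bᵀ * (c • (B * Bᵀ) + R)⁻¹ := by
        rw [← key, Matrix.mul_assoc _ Bᵀ, nonsing_inv_mul_cancel_left _ _ hSu]

/-- The ESRS analysis mean increment equals the Kalman gain increment:
`(1/(M-1)) A (I + (1/(M-1))(HA)ᵀR⁻¹HA)⁻¹ (HA)ᵀ R⁻¹ = P^f Hᵀ (H P^f Hᵀ + R)⁻¹`
with `P^f = (1/(M-1)) A Aᵀ`; consequently the ESRS mean update coincides with the
Kalman mean update for every observation `y` and mean `m`. -/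
theorem esrs_mean_equals_kalman
    (M n p : ℕ) (hM : 2 ≤ M)
    (A : Matrix (Fin n) (Fin M) ℝ) (H : Matrix (Fin p) (Fin n) ℝ)
    (R : Matrix (Fin p) (Fin p) ℝ) (hR : R.PosDef)
    (Pf : Matrix (Fin n) (Fin n) ℝ) (hPf : Pf = ((M : ℝ) - 1)⁻¹ • (A * Aᵀ)) :
    (((M : ℝ) - 1)⁻¹ •
        (A * (1 + ((M : ℝ) - 1)⁻¹ • ((H * A)ᵀ * R⁻¹ * (H * A)))⁻¹ * (H * A)ᵀ * R⁻¹)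
      = Pf * Hᵀ * (H * Pf * Hᵀ + R)⁻¹) ∧
    (∀ (y : Fin p → ℝ) (m : Fin n → ℝ),
      m + ((M : ℝ) - 1)⁻¹ •
          (A *ᵥ ((1 + ((M : ℝ) - 1)⁻¹ • ((H * A)ᵀ * R⁻¹ * (H * A)))⁻¹ *ᵥ
            ((H * A)ᵀ *ᵥ (R⁻¹ *ᵥ (y - H *ᵥ m)))))
        = m + (Pf * Hᵀ * (H * Pf * Hᵀ + R)⁻¹) *ᵥ (y - H *ᵥ m)) := by
  have hc : 0 ≤ ((M : ℝ) - 1)⁻¹ := by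
    have : (2 : ℝ) ≤ M := by exact_mod_cast hM
    exact inv_nonneg.mpr (by linarith)
  have gain : ((M : ℝ) - 1)⁻¹ •
        (A * (1 + ((M : ℝ) - 1)⁻¹ • ((H * A)ᵀ * R⁻¹ * (H * A)))⁻¹ * (H * A)ᵀ * R⁻¹)
      = Pf * Hᵀ * (H * Pf * Hᵀ + R)⁻¹ := by
    have h := hR.inv_one_add_smul_mul_transpose_mul_inv (H * A) hc
    have hHPH : H * Pf * Hᵀ = ((M : ℝ) - 1)⁻¹ • (H * A * (H * A)ᵀ) := by
      simp only [hPf, transpose_mul, Matrix.mul_smul, Matrix.smul_mul, Matrix.mul_assoc]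
    have hPH : Pf * Hᵀ = ((M : ℝ) - 1)⁻¹ • (A * (H * A)ᵀ) := by
      simp only [hPf, transpose_mul, Matrix.smul_mul, Matrix.mul_assoc]
    rw [hHPH, hPH, Matrix.smul_mul, Matrix.mul_assoc A (H * A)ᵀ, ← h]
    simp only [Matrix.mul_assoc]
  refine ⟨gain, fun y m => ?_⟩
  rw [← gain, smul_mulVec]
  simp only [mulVec_mulVec, Matrix.mul_assoc]
end

section
/- (Decomposition of the transport cost of the rotated NETS transformation.) Let M ≥ 1, let w ∈ ℝ^M be a probability vector, let Δ ∈ ℝ^{M×M} satisfy Δ𝟙 = 0 and Δᵀ𝟙 = 0, let Ω ∈ ℝ^{M×M} satisfy Ω𝟙 = 𝟙, and set D = w𝟙ᵀ + ΔΩ with entries d_{ij}. Let x^{(1)},…,x^{(M)} ∈ ℝ^n and let G ∈ ℝ^{M×M} be their Gram matrix, G_{ij} = ⟨x^{(i)}, x^{(j)}⟩. Then the transport cost satisfies ∑_{i,j=1}^M d_{ij}‖x^{(i)} − x^{(j)}‖² = M∑_{i=1}^M w_i‖x^{(i)}‖² + ∑_{j=1}^M ‖x^{(j)}‖² − 2·wᵀG𝟙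 − 2·trace(ΩᵀΔᵀG). In particular, only the term −2·trace(ΩᵀΔᵀG) depends on Ω, so minimizing the transport cost over admissible rotations Ω is equivalent to maximizing trace(ΩᵀΔᵀG). -/
open Matrix BigOperators
open scoped RealInnerProductSpace

/-- Expansion of a quadratic transport cost through the marginals of the coupling matrix. -/
theorem sum_mul_norm_sub_sq {ι E : Type*} [Fintype ι] [NormedAddCommGroup E]
    [InnerProductSpace ℝ E] (D : Matrix ι ι ℝ) (x : ι → E) :
    ∑ i, ∑ j, D i j * ‖x i - x j‖ ^ 2
      = ∑ i, (∑ j, D i j) * ‖x i‖ ^ 2 + ∑ j, (∑ i, D i j) * ‖x j‖ ^ 2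
        - 2 * ∑ i, ∑ j, D i j * ⟪x i, x j⟫ := by
  simp only [Finset.sum_mul, Finset.mul_sum]
  rw [Finset.sum_comm (f := fun j i => D i j * ‖x j‖ ^ 2)]
  simp only [← Finset.sum_add_distrib, ← Finset.sum_sub_distrib]
  refine Finset.sum_congr rfl fun i _ => Finset.sum_congr rfl fun j _ => ?_
  rw [norm_sub_sq_real]
  ring

/-- The trace pairing of two matrices as an entrywise sum. -/
theorem trace_transpose_mul_eq_sum {ι : Type*} [Fintype ι] (A B : Matrix ι ι ℝ) :
    (Aᵀ * B).trace = ∑ i, ∑ j, A i j * B i j := by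
  simp only [trace, diag_apply, mul_apply, transpose_apply]
  exact Finset.sum_comm

/-- Decomposition of the transport cost of the rotated NETS transformation
`D = w𝟙ᵀ + ΔΩ` (with `Δ𝟙 = 0`, `Δᵀ𝟙 = 0`, `Ω𝟙 = 𝟙`): the cost
`∑_{i,j} d_{ij} ‖x⁽ⁱ⁾ - x⁽ʲ⁾‖²` equals
`M ∑ᵢ wᵢ‖x⁽ⁱ⁾‖² + ∑ⱼ‖x⁽ʲ⁾‖² - 2 wᵀG𝟙 - 2 trace(ΩᵀΔᵀG)`,
where `G` is the Gram matrix of the ensemble members; only the last term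
depends on `Ω`. -/
theorem nets_transport_cost_decomposition
    (M nd : ℕ) (hM : 1 ≤ M) (w : Fin M → ℝ)
    (hw_nonneg : ∀ i, 0 ≤ w i) (hw_sum : ∑ i, w i = 1)
    (Δ Ω : Matrix (Fin M) (Fin M) ℝ)
    (hΔ1 : Δ *ᵥ (fun _ => (1 : ℝ)) = 0)
    (hΔ2 : (fun _ => (1 : ℝ)) ᵥ* Δ = 0)
    (hΩ1 : Ω *ᵥ (fun _ => (1 : ℝ)) = fun _ => 1)
    (D : Matrix (Fin M) (Fin M) ℝ)
    (hD : D = vecMulVec w (fun _ => 1) + Δ * Ω)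
    (x : Fin M → EuclideanSpace ℝ (Fin nd))
    (G : Matrix (Fin M) (Fin M) ℝ)
    (hG : ∀ i j, G i j = ⟪x i, x j⟫) :
    ∑ i, ∑ j, D i j * ‖x i - x j‖ ^ 2
      = (M : ℝ) * ∑ i, w i * ‖x i‖ ^ 2 + ∑ j, ‖x j‖ ^ 2
        - 2 * (w ⬝ᵥ (G *ᵥ (fun _ => (1 : ℝ))))
        - 2 * (Ωᵀ * Δᵀ * G).trace := by
  have hrow (i : Fin M) : ∑ j, (Δ * Ω) i j = 0 := by
    have h : (Δ * Ω) *ᵥ (fun _ => (1 : ℝ)) = 0 := by rw [← mulVec_mulVec, hΩ1, hΔ1]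
    simpa [mulVec, dotProduct] using congrFun h i
  have hcol (j : Fin M) : ∑ i, (Δ * Ω) i j = 0 := by
    have h : (fun _ => (1 : ℝ)) ᵥ* (Δ * Ω) = 0 := by rw [← vecMul_vecMul, hΔ2, zero_vecMul]
    simpa [vecMul, dotProduct] using congrFun h j
  have hDapp (i j : Fin M) : D i j = w i + (Δ * Ω) i j := by
    simp [hD, vecMulVec_apply]
  have hDrow (i : Fin M) : ∑ j, D i j = M * w i := by
    simp [hDapp, Finset.sum_add_distrib, hrow]
  have hDcol (j : Fin M) : ∑ i, D i j = 1 := by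
    simp only [hDapp, Finset.sum_add_distrib, hcol, hw_sum, add_zero]
  have hinner : ∑ i, ∑ j, D i j * ⟪x i, x j⟫
      = w ⬝ᵥ (G *ᵥ (fun _ => (1 : ℝ))) + (Ωᵀ * Δᵀ * G).trace := by
    rw [← transpose_mul, trace_transpose_mul_eq_sum]
    simp only [← hG, hDapp, add_mul, Finset.sum_add_distrib, dotProduct, mulVec, mul_one,
      Finset.mul_sum]
  rw [sum_mul_norm_sub_sq, hinner]
  simp only [hDrow, hDcol, one_mul, mul_assoc, ← Finset.mul_sum]
  ring
end
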